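/- arXiv:1611.08147 — 2 statements merged into one kernel-verified Lean document; each statement's English description precedes it below -/
import Mathlib

section
/- The contact bracket makes C^∞(ℝ^{1|2}) into a Lie superalgebra (the algebra 𝒦(2) of contact vector fields): for all homogeneous f, g, h in A one has {f,g} = −(−1)^{|f||g|}{g,f}, and the super Jacobi identity (−1)^{|f||h|}{f,{g,h}} + (−1)^{|g||f|}{g,{h,f}} + (−1)^{|h||g|}{h,{f,g}} = 0. -/
noncomputable section

namespace OSP

/-- Smooth real functions. -/
def Smooth (f : ℝ → ℝ) : Prop := ContDiff ℝ ((⊤ : ℕ∞) : WithTop ℕ∞) f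

theorem Smooth.const (c : ℝ) : Smooth fun _ => c := contDiff_const
theorem Smooth.add {f g : ℝ → ℝ} (hf : Smooth f) (hg : Smooth g) :
    Smooth fun x => f x + g x := ContDiff.add hf hg
theorem Smooth.mul {f g : ℝ → ℝ} (hf : Smooth f) (hg : Smooth g) :
    Smooth fun x => f x * g x := ContDiff.mul hf hg
theorem Smooth.neg {f : ℝ → ℝ} (hf : Smooth f) : Smooth fun x => -(f x) := ContDiff.neg hf
theorem Smooth.sub {f g : ℝ → ℝ} (hf : Smooth f) (hg : Smooth g) :
    Smooth fun x => f x - g x := ContDiff.sub hf hg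
theorem Smooth.smul (r : ℝ) {f : ℝ → ℝ} (hf : Smooth f) :
    Smooth fun x => r * f x := (Smooth.const r).mul hf
theorem Smooth.deriv {f : ℝ → ℝ} (hf : Smooth f) : Smooth (deriv f) :=
  (contDiff_infty_iff_deriv.mp hf).2
theorem Smooth.id : Smooth fun x : ℝ => x := contDiff_id

/-- The superalgebra `A = C^∞(ℝ^{1|2})`: elements `f₀ + f₁θ₁ + f₂θ₂ + f₁₂θ₁θ₂`
with smooth coefficients. -/
structure SA where
  c0 : ℝ → ℝ
  c1 : ℝ → ℝ
  c2 : ℝ → ℝ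
  c12 : ℝ → ℝ
  h0 : Smooth c0
  h1 : Smooth c1
  h2 : Smooth c2
  h12 : Smooth c12

namespace SA

instance : Zero SA :=
  ⟨⟨fun _ => 0, fun _ => 0, fun _ => 0, fun _ => 0,
    Smooth.const 0, Smooth.const 0, Smooth.const 0, Smooth.const 0⟩⟩

instance : One SA :=
  ⟨⟨fun _ => 1, fun _ => 0, fun _ => 0, fun _ => 0,
    Smooth.const 1, Smooth.const 0, Smooth.const 0, Smooth.const 0⟩⟩

instance : Add SA :=
  ⟨fun f g => ⟨fun x => f.c0 x + g.c0 x, fun x => f.c1 x + g.c1 x,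
    fun x => f.c2 x + g.c2 x, fun x => f.c12 x + g.c12 x,
    f.h0.add g.h0, f.h1.add g.h1, f.h2.add g.h2, f.h12.add g.h12⟩⟩

instance : Neg SA :=
  ⟨fun f => ⟨fun x => -(f.c0 x), fun x => -(f.c1 x), fun x => -(f.c2 x), fun x => -(f.c12 x),
    f.h0.neg, f.h1.neg, f.h2.neg, f.h12.neg⟩⟩

instance : Sub SA :=
  ⟨fun f g => ⟨fun x => f.c0 x - g.c0 x, fun x => f.c1 x - g.c1 x,
    fun x => f.c2 x - g.c2 x, fun x => f.c12 x - g.c12 x,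
    f.h0.sub g.h0, f.h1.sub g.h1, f.h2.sub g.h2, f.h12.sub g.h12⟩⟩

instance : SMul ℝ SA :=
  ⟨fun r f => ⟨fun x => r * f.c0 x, fun x => r * f.c1 x,
    fun x => r * f.c2 x, fun x => r * f.c12 x,
    f.h0.smul r, f.h1.smul r, f.h2.smul r, f.h12.smul r⟩⟩

/-- Supercommutative product determined by `θᵢθⱼ = -θⱼθᵢ`. -/
instance : Mul SA :=
  ⟨fun f g => ⟨fun x => f.c0 x * g.c0 x,
    fun x => f.c0 x * g.c1 x + f.c1 x * g.c0 x,
    fun x => f.c0 x * g.c2 x + f.c2 x * g.c0 x,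
    fun x => f.c0 x * g.c12 x + f.c12 x * g.c0 x + f.c1 x * g.c2 x - f.c2 x * g.c1 x,
    f.h0.mul g.h0,
    (f.h0.mul g.h1).add (f.h1.mul g.h0),
    (f.h0.mul g.h2).add (f.h2.mul g.h0),
    (((f.h0.mul g.h12).add (f.h12.mul g.h0)).add (f.h1.mul g.h2)).sub (f.h2.mul g.h1)⟩⟩

/-- The even coordinate `x`. -/
def xe : SA := ⟨fun x => x, fun _ => 0, fun _ => 0, fun _ => 0,
  Smooth.id, Smooth.const 0, Smooth.const 0, Smooth.const 0⟩

/-- `x²`. -/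
def xsq : SA := ⟨fun x => x * x, fun _ => 0, fun _ => 0, fun _ => 0,
  Smooth.id.mul Smooth.id, Smooth.const 0, Smooth.const 0, Smooth.const 0⟩

/-- `θ₁`. -/
def th1 : SA := ⟨fun _ => 0, fun _ => 1, fun _ => 0, fun _ => 0,
  Smooth.const 0, Smooth.const 1, Smooth.const 0, Smooth.const 0⟩

/-- `θ₂`. -/
def th2 : SA := ⟨fun _ => 0, fun _ => 0, fun _ => 1, fun _ => 0,
  Smooth.const 0, Smooth.const 0, Smooth.const 1, Smooth.const 0⟩

/-- `xθ₁`. -/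
def xth1 : SA := ⟨fun _ => 0, fun x => x, fun _ => 0, fun _ => 0,
  Smooth.const 0, Smooth.id, Smooth.const 0, Smooth.const 0⟩

/-- `xθ₂`. -/
def xth2 : SA := ⟨fun _ => 0, fun _ => 0, fun x => x, fun _ => 0,
  Smooth.const 0, Smooth.const 0, Smooth.id, Smooth.const 0⟩

/-- `θ₁θ₂`. -/
def th12 : SA := ⟨fun _ => 0, fun _ => 0, fun _ => 0, fun _ => 1,
  Smooth.const 0, Smooth.const 0, Smooth.const 0, Smooth.const 1⟩

/-- The even derivation `∂ₓ` (derivative of the coefficients). -/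
def dx (f : SA) : SA := ⟨deriv f.c0, deriv f.c1, deriv f.c2, deriv f.c12,
  f.h0.deriv, f.h1.deriv, f.h2.deriv, f.h12.deriv⟩

/-- The odd derivation `∂₁ = ∂/∂θ₁`. -/
def d1 (f : SA) : SA := ⟨f.c1, fun _ => 0, f.c12, fun _ => 0,
  f.h1, Smooth.const 0, f.h12, Smooth.const 0⟩

/-- The odd derivation `∂₂ = ∂/∂θ₂`. -/
def d2 (f : SA) : SA := ⟨f.c2, fun x => -(f.c12 x), fun _ => 0, fun _ => 0,
  f.h2, f.h12.neg, Smooth.const 0, Smooth.const 0⟩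

/-- `η̄₁ = ∂₁ - θ₁∂ₓ`. -/
def eta1 (f : SA) : SA := d1 f - th1 * dx f

/-- `η̄₂ = ∂₂ - θ₂∂ₓ`. -/
def eta2 (f : SA) : SA := d2 f - th2 * dx f

/-- `-∂ₓ` (so that `η̄ᵢ^{2j+1} = (-∂ₓ)^j ∘ η̄ᵢ`). -/
def ndx (f : SA) : SA := -(dx f)

/-- `f` is even: no `θ₁`, `θ₂` components. -/
def IsEven (f : SA) : Prop := (∀ x, f.c1 x = 0) ∧ (∀ x, f.c2 x = 0)

/-- `f` is odd: no `1`, `θ₁θ₂` components. -/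
def IsOdd (f : SA) : Prop := (∀ x, f.c0 x = 0) ∧ (∀ x, f.c12 x = 0)

/-- The sign `(-1)^p` of a parity `p` (`false` = even, `true` = odd). -/
def sgn (p : Bool) : ℝ := if p then -1 else 1

/-- `f` is homogeneous of parity `p`. -/
def Homog (p : Bool) (f : SA) : Prop := if p then IsOdd f else IsEven f

/-- The contact (Poisson) bracket `{f,g}` for `f` homogeneous of parity `p`:
`{f,g} = fg' - f'g - ½(-1)^{|f|}(η̄₁(f)η̄₁(g) + η̄₂(f)η̄₂(g))`. -/
def cbr (p : Bool) (f g : SA) : SA :=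
  f * dx g - dx f * g - (sgn p / 2) • (eta1 f * eta1 g + eta2 f * eta2 g)

/-- Even part of `f`. -/
def evenPart (f : SA) : SA := ⟨f.c0, fun _ => 0, fun _ => 0, f.c12,
  f.h0, Smooth.const 0, Smooth.const 0, f.h12⟩

/-- Odd part of `f`. -/
def oddPart (f : SA) : SA := ⟨fun _ => 0, f.c1, f.c2, fun _ => 0,
  Smooth.const 0, f.h1, f.h2, Smooth.const 0⟩

/-- The contact bracket extended bilinearly to all of `A`. -/
def cbrT (f g : SA) : SA := cbr false (evenPart f) g + cbr true (oddPart f) g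

/-- Membership in `𝔬𝔰𝔭(2|2) = Span(1, x, x², θ₁, θ₂, xθ₁, xθ₂, θ₁θ₂)`. -/
def memOsp (f : SA) : Prop :=
  ∃ a b c d e p q r : ℝ,
    f = a • (1 : SA) + b • xe + c • xsq + d • th1 + e • th2
      + p • xth1 + q • xth2 + r • th12

/-- The action `𝔏^λ_f` on λ-densities, for `f` homogeneous of parity `p`. -/
def Ld (lam : ℝ) (p : Bool) (f g : SA) : SA :=
  f * dx g + lam • (dx f * g) - (sgn p / 2) • (eta1 f * eta1 g + eta2 f * eta2 g)

/-- The `(λ,μ)`-action of homogeneous `f` (parity `p`) on a homogeneous operator `T`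
(parity `t`): `f·T = 𝔏^μ_f ∘ T - (-1)^{|f||T|} T ∘ 𝔏^λ_f`. -/
def act (lam mu : ℝ) (p t : Bool) (f : SA) (T : SA → SA) : SA → SA :=
  fun h => Ld mu p f (T h) - sgn (p && t) • T (Ld lam p f h)

/-- The 1-cochain `ω(f) = m_{f'}`. -/
def om (f : SA) : SA → SA := fun h => dx f * h

/-- The 1-cochain
`ω̃_λ(f) = 2λ m_{η̄₁(∂₂f)} - (-1)^{|f|}(m_{∂₂f}∘η̄₁ + m_{θ₂η̄₂η̄₁(f)}∘η̄₂)`. -/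
def omt (lam : ℝ) (p : Bool) (f : SA) : SA → SA := fun h =>
  (2 * lam) • (eta1 (d2 f) * h)
    - sgn p • (d2 f * eta1 h + (th2 * eta2 (eta1 f)) * eta2 h)

/-- The 1-cochain `γ̃₀(f) = m_{η̄₁η̄₂(f)}`. -/
def gamt0 (f : SA) : SA → SA := fun h => eta1 (eta2 f) * h

/-- The 1-cochain `Γ_k(f) = m_{f'}∘η̄₁∘η̄₂^{2k-1}`. -/
def Gam (k : ℕ) (f : SA) : SA → SA := fun h => dx f * eta1 (ndx^[k - 1] (eta2 h))

/-- The 1-cochain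
`Γ̃_k(f) = k m_{η̄₁(∂₂f)}∘η̄₁∘η̄₂^{2k-1} - (-1)^{|f|}(m_{∂₂f}∘η̄₂^{2k+1} - m_{η̄₁(θ₂∂₂f)}∘η̄₁^{2k+1})`. -/
def GamT (k : ℕ) (p : Bool) (f : SA) : SA → SA := fun h =>
  (k : ℝ) • (eta1 (d2 f) * eta1 (ndx^[k - 1] (eta2 h)))
    - sgn p • (d2 f * ndx^[k] (eta2 h) - eta1 (th2 * d2 f) * ndx^[k] (eta1 h))

/-- The 1-cochain
`Γ̄_k(f) = (k-1) m_{f''}∘η̄₁∘η̄₂^{2k-3} + (-1)^{|f|}(m_{η̄₂(f')}∘η̄₁^{2k-1} - m_{η̄₁(f')}∘η̄₂^{2k-1})`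
(the first term is absent for `k = 1`, its coefficient being `0`). -/
def GamB (k : ℕ) (p : Bool) (f : SA) : SA → SA := fun h =>
  ((k : ℝ) - 1) • (dx (dx f) * eta1 (ndx^[k - 2] (eta2 h)))
    + sgn p • (eta2 (dx f) * ndx^[k - 1] (eta1 h) - eta1 (dx f) * ndx^[k - 1] (eta2 h))

/-- An operator on `A` is even if it preserves parities. -/
def OpEven (T : SA → SA) : Prop :=
  (∀ g, IsEven g → IsEven (T g)) ∧ (∀ g, IsOdd g → IsOdd (T g))

/-- An operator on `A` is odd if it reverses parities. -/
def OpOdd (T : SA → SA) : Prop :=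
  (∀ g, IsEven g → IsOdd (T g)) ∧ (∀ g, IsOdd g → IsEven (T g))

/-- An operator is homogeneous of parity `p`. -/
def OpHomog (p : Bool) (T : SA → SA) : Prop := if p then OpOdd T else OpEven T

/-- The monomial differential operator `m_A ∘ ∂ₓ^i ∘ ∂₁^j ∘ ∂₂^l`. -/
def mono (A : SA) (i : ℕ) (j l : Bool) (g : SA) : SA :=
  A * dx^[i] ((if j then d1 else id) ((if l then d2 else id) g))

/-- A differential operator on `A` is a finite sum `Σ m_{A_{ijl}}∘∂ₓ^i∘∂₁^j∘∂₂^l`. -/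
def IsDiffOp (T : SA → SA) : Prop :=
  ∃ L : List (SA × ℕ × Bool × Bool),
    T = fun g => (L.map fun t => mono t.1 t.2.1 t.2.2.1 t.2.2.2 g).sum

/-- Supercommutator `[S,T] = S∘T - (-1)^{|S||T|} T∘S`, with the sign `s = (-1)^{|S||T|}`
given explicitly. -/
def scomm {M : Type*} [Sub M] [SMul ℝ M] (s : ℝ) (S T : M → M) : M → M :=
  fun v => S (T v) - s • T (S v)

/-- Cup product of two even 1-cochains on homogeneous arguments of parities `p`, `q`:
`(a∨b)(f,g) = [a(f),b(g)] + [b(f),a(g)]`. -/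
def cup {M : Type*} [Sub M] [SMul ℝ M] [Add M] (p q : Bool)
    (a b : Bool → SA → M → M) (f g : SA) : M → M :=
  fun v => scomm (sgn (p && q)) (a p f) (b q g) v + scomm (sgn (p && q)) (b p f) (a q g) v

/-! Operators on `𝔉_{-k/2} ⊕ 𝔉_{k/2}`, modelled as `SA × SA`
(first factor `𝔉_{-k/2}`, second factor `𝔉_{k/2}`). -/

/-- `γ_k = ω` acting on the summand `𝔉_{k/2}`, extended by zero. -/
def gamP (_ : Bool) (f : SA) : SA × SA → SA × SA := fun v => (0, om f v.2)

/-- `γ_{-k} = ω` acting on the summand `𝔉_{-k/2}`, extended by zero. -/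
def gamM (_ : Bool) (f : SA) : SA × SA → SA × SA := fun v => (om f v.1, 0)

/-- `γ̃_k = ω̃_{k/2}` acting on the summand `𝔉_{k/2}`, extended by zero. -/
def gamtP (k : ℕ) (p : Bool) (f : SA) : SA × SA → SA × SA :=
  fun v => (0, omt ((k : ℝ) / 2) p f v.2)

/-- `γ̃_{-k} = ω̃_{-k/2}` acting on the summand `𝔉_{-k/2}`, extended by zero. -/
def gamtM (k : ℕ) (p : Bool) (f : SA) : SA × SA → SA × SA :=
  fun v => (omt (-(k : ℝ) / 2) p f v.1, 0)

/-- `Γ_k` viewed as an operator from `𝔉_{-k/2}` to `𝔉_{k/2}`. -/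
def GamP (k : ℕ) (_ : Bool) (f : SA) : SA × SA → SA × SA := fun v => (0, Gam k f v.1)

/-- `Γ̃_k` viewed as an operator from `𝔉_{-k/2}` to `𝔉_{k/2}`. -/
def GamTP (k : ℕ) (p : Bool) (f : SA) : SA × SA → SA × SA := fun v => (0, GamT k p f v.1)

/-- `Γ̄_k` viewed as an operator from `𝔉_{-k/2}` to `𝔉_{k/2}`. -/
def GamBP (k : ℕ) (p : Bool) (f : SA) : SA × SA → SA × SA := fun v => (0, GamB k p f v.1)

/-- The undeformed action `𝕃_f = 𝔏^{-k/2}_f ⊕ 𝔏^{k/2}_f` on `𝔉_{-k/2} ⊕ 𝔉_{k/2}`. -/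
def LL (k : ℕ) (p : Bool) (f : SA) : SA × SA → SA × SA :=
  fun v => (Ld (-(k : ℝ) / 2) p f v.1, Ld ((k : ℝ) / 2) p f v.2)

/-- The action of homogeneous `f` (parity `p`) on a homogeneous operator `T` (parity `t`)
on `𝔉_{-k/2} ⊕ 𝔉_{k/2}`: `f·T = [𝕃_f, T]`. -/
def actP (k : ℕ) (p t : Bool) (f : SA) (T : SA × SA → SA × SA) : SA × SA → SA × SA :=
  fun v => LL k p f (T v) - sgn (p && t) • T (LL k p f v)

/-- Parity predicates on `𝔉_{-k/2} ⊕ 𝔉_{k/2}`. -/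
def IsEvenP (v : SA × SA) : Prop := IsEven v.1 ∧ IsEven v.2

def IsOddP (v : SA × SA) : Prop := IsOdd v.1 ∧ IsOdd v.2

def OpEvenP (T : SA × SA → SA × SA) : Prop :=
  (∀ v, IsEvenP v → IsEvenP (T v)) ∧ (∀ v, IsOddP v → IsOddP (T v))

def OpOddP (T : SA × SA → SA × SA) : Prop :=
  (∀ v, IsEvenP v → IsOddP (T v)) ∧ (∀ v, IsOddP v → IsEvenP (T v))

def OpHomogP (p : Bool) (T : SA × SA → SA × SA) : Prop := if p then OpOddP T else OpEvenP T

/-- A differential-operator-valued endomorphism of `𝔉_{-k/2} ⊕ 𝔉_{k/2}`: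
a 2×2 block matrix of differential operators. -/
def IsDiffOpP (T : SA × SA → SA × SA) : Prop :=
  ∃ T11 T12 T21 T22 : SA → SA,
    IsDiffOp T11 ∧ IsDiffOp T12 ∧ IsDiffOp T21 ∧ IsDiffOp T22 ∧
    T = fun v => (T11 v.1 + T12 v.2, T21 v.1 + T22 v.2)

/-- A differential operator from `𝔉_{-k/2}` to `𝔉_{k/2}`, as an endomorphism of the sum. -/
def IsDiffOpLower (T : SA × SA → SA × SA) : Prop :=
  ∃ D : SA → SA, IsDiffOp D ∧ T = fun v => (0, D v.1)

end SA

end OSP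
namespace OSP
set_option linter.unusedSimpArgs false
namespace SA

theorem ext_pt {f g : SA} (h0 : ∀ x, f.c0 x = g.c0 x) (h1 : ∀ x, f.c1 x = g.c1 x)
    (h2 : ∀ x, f.c2 x = g.c2 x) (h12 : ∀ x, f.c12 x = g.c12 x) : f = g := by
  cases f; cases g
  simp only [SA.mk.injEq]
  exact ⟨funext h0, funext h1, funext h2, funext h12⟩

theorem Smooth.diff {f : ℝ → ℝ} (hf : Smooth f) : Differentiable ℝ f :=
  ContDiff.differentiable hf (by simp)

section comps
variable (f g : SA) (r : ℝ)
theorem zero_c0 : (0 : SA).c0 = fun _ => 0 := rfl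
theorem zero_c1 : (0 : SA).c1 = fun _ => 0 := rfl
theorem zero_c2 : (0 : SA).c2 = fun _ => 0 := rfl
theorem zero_c12 : (0 : SA).c12 = fun _ => 0 := rfl
theorem add_c0 : (f + g).c0 = fun x => f.c0 x + g.c0 x := rfl
theorem add_c1 : (f + g).c1 = fun x => f.c1 x + g.c1 x := rfl
theorem add_c2 : (f + g).c2 = fun x => f.c2 x + g.c2 x := rfl
theorem add_c12 : (f + g).c12 = fun x => f.c12 x + g.c12 x := rfl
theorem sub_c0 : (f - g).c0 = fun x => f.c0 x - g.c0 x := rfl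
theorem sub_c1 : (f - g).c1 = fun x => f.c1 x - g.c1 x := rfl
theorem sub_c2 : (f - g).c2 = fun x => f.c2 x - g.c2 x := rfl
theorem sub_c12 : (f - g).c12 = fun x => f.c12 x - g.c12 x := rfl
theorem neg_c0 : (-f).c0 = fun x => -f.c0 x := rfl
theorem neg_c1 : (-f).c1 = fun x => -f.c1 x := rfl
theorem neg_c2 : (-f).c2 = fun x => -f.c2 x := rfl
theorem neg_c12 : (-f).c12 = fun x => -f.c12 x := rfl
theorem smul_c0 : (r • f).c0 = fun x => r * f.c0 x := rfl
theorem smul_c1 : (r • f).c1 = fun x => r * f.c1 x := rfl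
theorem smul_c2 : (r • f).c2 = fun x => r * f.c2 x := rfl
theorem smul_c12 : (r • f).c12 = fun x => r * f.c12 x := rfl
theorem mul_c0 : (f * g).c0 = fun x => f.c0 x * g.c0 x := rfl
theorem mul_c1 : (f * g).c1 = fun x => f.c0 x * g.c1 x + f.c1 x * g.c0 x := rfl
theorem mul_c2 : (f * g).c2 = fun x => f.c0 x * g.c2 x + f.c2 x * g.c0 x := rfl
theorem mul_c12 : (f * g).c12 = fun x =>
    f.c0 x * g.c12 x + f.c12 x * g.c0 x + f.c1 x * g.c2 x - f.c2 x * g.c1 x := rfl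

/-- Components of the bracket. -/
theorem cbr_c0 (p : Bool) : (cbr p f g).c0 = fun x =>
    f.c0 x * deriv g.c0 x - deriv f.c0 x * g.c0 x
      - sgn p / 2 * (f.c1 x * g.c1 x + f.c2 x * g.c2 x) := by
  funext x
  simp only [cbr, eta1, eta2, d1, d2, dx, th1, th2, add_c0, sub_c0, smul_c0, mul_c0]
  ring
theorem cbr_c1 (p : Bool) : (cbr p f g).c1 = fun x =>
    f.c0 x * deriv g.c1 x + f.c1 x * deriv g.c0 x - deriv f.c0 x * g.c1 x - deriv f.c1 x * g.c0 x
      - sgn p / 2 * (-(f.c1 x * deriv g.c0 x) - deriv f.c0 x * g.c1 x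
        - f.c2 x * g.c12 x - f.c12 x * g.c2 x) := by
  funext x
  simp only [cbr, eta1, eta2, d1, d2, dx, th1, th2, add_c0, sub_c0, smul_c0, mul_c0,
    add_c1, sub_c1, smul_c1, mul_c1]
  ring
theorem cbr_c2 (p : Bool) : (cbr p f g).c2 = fun x =>
    f.c0 x * deriv g.c2 x + f.c2 x * deriv g.c0 x - deriv f.c0 x * g.c2 x - deriv f.c2 x * g.c0 x
      - sgn p / 2 * (-(f.c2 x * deriv g.c0 x) - deriv f.c0 x * g.c2 x
        + f.c1 x * g.c12 x + f.c12 x * g.c1 x) := by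
  funext x
  simp only [cbr, eta1, eta2, d1, d2, dx, th1, th2, add_c0, sub_c0, smul_c0, mul_c0,
    add_c2, sub_c2, smul_c2, mul_c2]
  ring
theorem cbr_c12 (p : Bool) : (cbr p f g).c12 = fun x =>
    f.c0 x * deriv g.c12 x + f.c12 x * deriv g.c0 x + f.c1 x * deriv g.c2 x - f.c2 x * deriv g.c1 x
      - (deriv f.c0 x * g.c12 x + deriv f.c12 x * g.c0 x + deriv f.c1 x * g.c2 x
        - deriv f.c2 x * g.c1 x)
      - sgn p / 2 * (-(f.c1 x * deriv g.c2 x) - deriv f.c2 x * g.c1 x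
        - deriv f.c0 x * g.c12 x + f.c12 x * deriv g.c0 x
        + f.c2 x * deriv g.c1 x + deriv f.c1 x * g.c2 x
        + f.c12 x * deriv g.c0 x - deriv f.c0 x * g.c12 x) := by
  funext x
  simp only [cbr, eta1, eta2, d1, d2, dx, th1, th2, add_c0, sub_c0, smul_c0, mul_c0,
    add_c1, sub_c1, smul_c1, mul_c1, add_c2, sub_c2, smul_c2, mul_c2,
    add_c12, sub_c12, smul_c12, mul_c12]
  ring
end comps

end SA
end OSP

namespace OSP
namespace SA
set_option linter.unusedSimpArgs false

set_option maxHeartbeats 4000000 in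
/-- The contact bracket makes `C^∞(ℝ^{1|2})` into a Lie superalgebra:
graded antisymmetry `{f,g} = -(-1)^{|f||g|}{g,f}` and the super Jacobi identity. -/
theorem contact_bracket_lie_superalgebra :
    (∀ (p q : Bool) (f g : SA), Homog p f → Homog q g →
      cbr p f g = -(sgn (p && q) • cbr q g f)) ∧
    (∀ (p q r : Bool) (f g h : SA), Homog p f → Homog q g → Homog r h →
      sgn (p && r) • cbr p f (cbr q g h) + sgn (q && p) • cbr q g (cbr r h f)
        + sgn (r && q) • cbr r h (cbr p f g) = 0) := by

  refine ⟨?_, ?_⟩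
  · intro p q f g hf hg
    cases p <;> cases q <;>
      simp only [Homog, IsEven, IsOdd, Bool.false_eq_true, if_true, if_false] at hf hg
    all_goals
      obtain ⟨hf1, hf2⟩ := hf
      obtain ⟨hg1, hg2⟩ := hg
      have ef1 := funext hf1
      have ef2 := funext hf2
      have eg1 := funext hg1
      have eg2 := funext hg2
      apply ext_pt <;> intro x <;>
      simp only [neg_c0, neg_c1, neg_c2, neg_c12, smul_c0, smul_c1, smul_c2, smul_c12,
        cbr_c0, cbr_c1, cbr_c2, cbr_c12, ef1, ef2, eg1, eg2, deriv_const', sgn,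
        Bool.and_true, Bool.and_false, if_true, if_false, Bool.false_eq_true] <;>
      ring
  · intro p q r f g h hf hg hh
    have f0 := Smooth.diff f.h0
    have f1 := Smooth.diff f.h1
    have f2 := Smooth.diff f.h2
    have f12 := Smooth.diff f.h12
    have g0 := Smooth.diff g.h0
    have g1 := Smooth.diff g.h1
    have g2 := Smooth.diff g.h2
    have g12 := Smooth.diff g.h12
    have k0 := Smooth.diff h.h0
    have k1 := Smooth.diff h.h1
    have k2 := Smooth.diff h.h2
    have k12 := Smooth.diff h.h12
    have f0' := Smooth.diff f.h0.deriv
    have f1' := Smooth.diff f.h1.deriv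
    have f2' := Smooth.diff f.h2.deriv
    have f12' := Smooth.diff f.h12.deriv
    have g0' := Smooth.diff g.h0.deriv
    have g1' := Smooth.diff g.h1.deriv
    have g2' := Smooth.diff g.h2.deriv
    have g12' := Smooth.diff g.h12.deriv
    have k0' := Smooth.diff h.h0.deriv
    have k1' := Smooth.diff h.h1.deriv
    have k2' := Smooth.diff h.h2.deriv
    have k12' := Smooth.diff h.h12.deriv
    cases p <;> cases q <;> cases r <;>
      simp only [Homog, IsEven, IsOdd, Bool.false_eq_true, if_true, if_false] at hf hg hh
    all_goals
      obtain ⟨hf1, hf2⟩ := hf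
      obtain ⟨hg1, hg2⟩ := hg
      obtain ⟨hh1, hh2⟩ := hh
      have ef1 := funext hf1
      have ef2 := funext hf2
      have eg1 := funext hg1
      have eg2 := funext hg2
      have eh1 := funext hh1
      have eh2 := funext hh2
      apply ext_pt <;> intro x <;>
      simp only [zero_c0, zero_c1, zero_c2, zero_c12, add_c0, add_c1, add_c2, add_c12,
        smul_c0, smul_c1, smul_c2, smul_c12,
        cbr_c0, cbr_c1, cbr_c2, cbr_c12, ef1, ef2, eg1, eg2, eh1, eh2, deriv_const', sgn,
        Bool.and_true, Bool.and_false, if_true, if_false, Bool.false_eq_true,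
        mul_zero, zero_mul, add_zero, zero_add, sub_zero, neg_zero, sub_self, zero_sub] <;>
      simp (disch := fun_prop) only [deriv_fun_add, deriv_fun_sub, deriv_fun_mul, deriv.fun_neg,
        deriv_const_mul_field, deriv_const', deriv_const] <;>
      ring

end SA
end OSP
end
end

section
/- For every integer k ≥ 1, the even linear map Γ̄_k(f) = (k−1) m_{f″}∘η̄₁∘η̄₂^{2k−3} + (−1)^{|f|}(m_{η̄₂(f′)}∘η̄₁^{2k−1} − m_{η̄₁(f′)}∘η̄₂^{2k−1}) (for k = 1 the first term is absent) is a 1-cocycle of 𝔬𝔰𝔭(2|2) with values in 𝔇_{−k/2,k/2}: for all homogeneous f, g ∈ 𝔬𝔰𝔭(2|2), f·Γ̄_k(g) − (−1)^{|f||g|} g·Γ̄_k(f) − Γ̄_k({f,g}) = 0 for the (−k/2, k/2)-action. -/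
noncomputable section

namespace OSP
namespace SA


set_option linter.unusedSimpArgs false
set_option linter.unusedVariables false

@[ext] theorem ext' {f g : SA} (h0 : f.c0 = g.c0) (h1 : f.c1 = g.c1) (h2 : f.c2 = g.c2)
    (h12 : f.c12 = g.c12) : f = g := by
  cases f; cases g; simp at *; exact ⟨h0, h1, h2, h12⟩

section comps
variable (f g : SA) (r : ℝ)
theorem dx_c0 : (dx f).c0 = deriv f.c0 := rfl
theorem dx_c1 : (dx f).c1 = deriv f.c1 := rfl
theorem dx_c2 : (dx f).c2 = deriv f.c2 := rfl
theorem dx_c12 : (dx f).c12 = deriv f.c12 := rfl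
theorem one_c0 : (1 : SA).c0 = fun _ => 1 := rfl
theorem one_c1 : (1 : SA).c1 = fun _ => 0 := rfl
theorem one_c2 : (1 : SA).c2 = fun _ => 0 := rfl
theorem one_c12 : (1 : SA).c12 = fun _ => 0 := rfl

theorem eta1_c0 : (eta1 f).c0 = f.c1 := by
  funext x; simp [eta1, sub_c0, mul_c0, d1, th1]
theorem eta1_c1 : (eta1 f).c1 = fun x => -deriv f.c0 x := by
  funext x; simp [eta1, sub_c1, mul_c1, d1, th1, dx]
theorem eta1_c2 : (eta1 f).c2 = f.c12 := by
  funext x; simp [eta1, sub_c2, mul_c2, d1, th1]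
theorem eta1_c12 : (eta1 f).c12 = fun x => -deriv f.c2 x := by
  funext x; simp [eta1, sub_c12, mul_c12, d1, th1, dx]
theorem eta2_c0 : (eta2 f).c0 = f.c2 := by
  funext x; simp [eta2, sub_c0, mul_c0, d2, th2]
theorem eta2_c1 : (eta2 f).c1 = fun x => -f.c12 x := by
  funext x; simp [eta2, sub_c1, mul_c1, d2, th2]
theorem eta2_c2 : (eta2 f).c2 = fun x => -deriv f.c0 x := by
  funext x; simp [eta2, sub_c2, mul_c2, d2, th2, dx]
theorem eta2_c12 : (eta2 f).c12 = fun x => deriv f.c1 x := by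
  funext x; simp [eta2, sub_c12, mul_c12, d2, th2, dx]
end comps

/-- iterated derivatives -/
def J (u : ℝ → ℝ) (n : ℕ) : ℝ → ℝ := iteratedDeriv n u

theorem J_zero (u : ℝ → ℝ) : J u 0 = u := iteratedDeriv_zero
theorem J_hasDerivAt {u : ℝ → ℝ} (hu : Smooth u) (n : ℕ) (x : ℝ) :
    HasDerivAt (J u n) (J u (n + 1) x) x := by
  have h := (ContDiff.differentiable_iteratedDeriv (n := ((⊤ : ℕ∞) : WithTop ℕ∞)) n hu
    (by exact_mod_cast WithTop.coe_lt_top n)) x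
  have h2 := h.hasDerivAt
  rw [← iteratedDeriv_succ] at h2
  exact h2
theorem J_succ (u : ℝ → ℝ) (n : ℕ) : J u (n + 1) = deriv (J u n) := iteratedDeriv_succ
theorem J_deriv (u : ℝ → ℝ) (n : ℕ) : J (deriv u) n = J u (n + 1) := iteratedDeriv_succ'.symm
theorem J_neg (u : ℝ → ℝ) (n : ℕ) : J (fun x => -u x) n = fun x => -J u n x := by
  funext x
  exact iteratedDeriv_fun_neg n u x

/-- uniqueness of derivative sequences -/
theorem J_unique (G : ℕ → ℝ → ℝ) (h : ∀ n x, HasDerivAt (G n) (G (n + 1) x) x) (n : ℕ) :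
    J (G 0) n = G n := by
  induction n with
  | zero => exact J_zero _
  | succ n ih => rw [J_succ, ih]; funext x; exact (h n x).deriv

/-- general first order expression with polynomial coefficients -/
def Fm (a b c s t d e y z : ℝ) (u w v v' : ℝ → ℝ) : ℝ → ℝ := fun x =>
  (a + b * x + c * x ^ 2) * deriv u x + (s + t * x) * deriv w x + (d + e * x) * v x
    + (y + z * x) * v' x

theorem J_lin (d e : ℝ) {v : ℝ → ℝ} (hv : Smooth v) (n : ℕ) (x : ℝ) :
    HasDerivAt (fun x => (d + e * x) * J v n x + n * e * J v (n - 1) x)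
      ((d + e * x) * J v (n + 1) x + ((n + 1 : ℕ) : ℝ) * e * J v (n + 1 - 1) x) x := by
  have hl : HasDerivAt (fun x : ℝ => d + e * x) e x := by
    simpa using ((hasDerivAt_id x).const_mul e).const_add d
  have h1 := (hl.mul (J_hasDerivAt hv n x)).add
    ((J_hasDerivAt hv (n - 1) x).const_mul ((n : ℝ) * e))
  refine HasDerivAt.congr_deriv h1 ?_
  rcases n with _ | n
  · simp; ring
  · simp; ring

theorem J_quad (a b c : ℝ) {v : ℝ → ℝ} (hv : Smooth v) (n : ℕ) (x : ℝ) :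
    HasDerivAt (fun x => (a + b * x + c * x ^ 2) * J v (n + 1) x
        + n * (b + 2 * c * x) * J v n x + n * (n - 1) * c * J v (n - 1) x)
      ((a + b * x + c * x ^ 2) * J v (n + 1 + 1) x
        + ((n + 1 : ℕ) : ℝ) * (b + 2 * c * x) * J v (n + 1) x
        + ((n + 1 : ℕ) : ℝ) * (((n + 1 : ℕ) : ℝ) - 1) * c * J v (n + 1 - 1) x) x := by
  have hl : HasDerivAt (fun x : ℝ => a + b * x + c * x ^ 2) (b + 2 * c * x) x := by
    have := (((hasDerivAt_id x).const_mul b).const_add a).add ((hasDerivAt_pow 2 x).const_mul c)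
    refine HasDerivAt.congr_deriv this ?_
    simp; ring
  have hl2 : HasDerivAt (fun x : ℝ => (n : ℝ) * (b + 2 * c * x)) (n * (2 * c)) x := by
    simpa using (((hasDerivAt_id x).const_mul (2 * c)).const_add b).const_mul (n : ℝ)
  have h1 := ((hl.mul (J_hasDerivAt hv (n + 1) x)).add (hl2.mul (J_hasDerivAt hv n x))).add
    ((J_hasDerivAt hv (n - 1) x).const_mul ((n : ℝ) * (n - 1) * c))
  refine HasDerivAt.congr_deriv h1 ?_
  rcases n with _ | n
  · simp; ring
  · simp; ring

theorem J_Fm (a b c s t d e y z : ℝ) {u w v v' : ℝ → ℝ} (hu : Smooth u) (hw : Smooth w)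
    (hv : Smooth v) (hv' : Smooth v') (n : ℕ) :
    J (Fm a b c s t d e y z u w v v') n = fun x =>
      ((a + b * x + c * x ^ 2) * J u (n + 1) x
        + n * (b + 2 * c * x) * J u n x + n * (n - 1) * c * J u (n - 1) x)
      + ((s + t * x + 0 * x ^ 2) * J w (n + 1) x
        + n * (t + 2 * 0 * x) * J w n x + n * (n - 1) * 0 * J w (n - 1) x)
      + ((d + e * x) * J v n x + n * e * J v (n - 1) x)
      + ((y + z * x) * J v' n x + n * z * J v' (n - 1) x) := by
  have := J_unique (fun n x =>
      ((a + b * x + c * x ^ 2) * J u (n + 1) x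
        + n * (b + 2 * c * x) * J u n x + n * (n - 1) * c * J u (n - 1) x)
      + ((s + t * x + 0 * x ^ 2) * J w (n + 1) x
        + n * (t + 2 * 0 * x) * J w n x + n * (n - 1) * 0 * J w (n - 1) x)
      + ((d + e * x) * J v n x + n * e * J v (n - 1) x)
      + ((y + z * x) * J v' n x + n * z * J v' (n - 1) x)) (fun n x =>
        (((J_quad a b c hu n x).add (J_quad s t 0 hw n x)).add (J_lin d e hv n x)).add
          (J_lin y z hv' n x)) n
  rw [← this]
  congr 1
  funext x
  simp [Fm, J_succ, J_zero]

theorem deriv_J2 (A B : ℝ) {u v : ℝ → ℝ} (hu : Smooth u) (hv : Smooth v) (n m : ℕ) :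
    deriv (fun x => A * J u n x + B * J v m x)
      = fun x => A * J u (n + 1) x + B * J v (m + 1) x := by
  funext x
  exact (((J_hasDerivAt hu n x).const_mul A).add ((J_hasDerivAt hv m x).const_mul B)).deriv

/-- even elements of osp(2|2) -/
def mkE (a b c r : ℝ) : SA := ⟨fun x => a + b * x + c * x ^ 2, fun _ => 0, fun _ => 0, fun _ => r,
  by unfold Smooth; fun_prop, Smooth.const 0, Smooth.const 0, Smooth.const r⟩
/-- odd elements of osp(2|2) -/
def mkO (d p e q : ℝ) : SA := ⟨fun _ => 0, fun x => d + p * x, fun x => e + q * x, fun _ => 0,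
  Smooth.const 0, by unfold Smooth; fun_prop, by unfold Smooth; fun_prop, Smooth.const 0⟩

theorem deriv_q (a b c : ℝ) : deriv (fun x : ℝ => a + b * x + c * x ^ 2)
    = fun x => b + 2 * c * x := by
  funext x
  have := (((hasDerivAt_id x).const_mul b).const_add a).add ((hasDerivAt_pow 2 x).const_mul c)
  refine Eq.trans this.deriv ?_
  simp; ring
theorem deriv_l (a b : ℝ) : deriv (fun x : ℝ => a + b * x) = fun _ => b := by
  funext x
  have := (((hasDerivAt_id x).const_mul b).const_add a)
  refine Eq.trans this.deriv ?_
  simp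

theorem exists_mkE {f : SA} (hf : memOsp f) (he : Homog false f) :
    ∃ a b c r, f = mkE a b c r := by
  obtain ⟨a, b, c, d, e, p, q, r, rfl⟩ := hf
  refine ⟨a, b, c, r, ?_⟩
  simp only [Homog] at he
  obtain ⟨h1, h2⟩ := (show IsEven _ by simpa using he)
  ext x
  · simp [add_c0, smul_c0, one_c0, xe, xsq, th1, th2, xth1, xth2, th12, mkE, pow_two]
  · rw [h1 x]; simp [mkE]
  · rw [h2 x]; simp [mkE]
  · simp [add_c12, smul_c12, one_c12, xe, xsq, th1, th2, xth1, xth2, th12, mkE]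

theorem exists_mkO {f : SA} (hf : memOsp f) (he : Homog true f) :
    ∃ d p e q, f = mkO d p e q := by
  obtain ⟨a, b, c, d, e, p, q, r, rfl⟩ := hf
  refine ⟨d, p, e, q, ?_⟩
  simp only [Homog] at he
  obtain ⟨h1, h2⟩ := (show IsOdd _ by simpa using he)
  ext x
  · rw [h1 x]; simp [mkO]
  · simp [add_c1, smul_c1, one_c1, xe, xsq, th1, th2, xth1, xth2, th12, mkO]
  · simp [add_c2, smul_c2, one_c2, xe, xsq, th1, th2, xth1, xth2, th12, mkO]
  · rw [h2 x]; simp [mkO]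

section Ldcomps
variable (lam a b c r d p e q : ℝ) (h : SA)
theorem LdE_c0 : (Ld lam false (mkE a b c r) h).c0 =
    Fm a b c 0 0 (lam * b) (lam * (2 * c)) 0 0 h.c0 h.c0 h.c0 h.c0 := by
  funext x
  simp [Ld, Fm, add_c0, sub_c0, smul_c0, mul_c0, dx_c0, eta1_c0, eta2_c0, mkE, sgn, deriv_q]
  try ring
theorem LdE_c1 : (Ld lam false (mkE a b c r) h).c1 =
    Fm a b c 0 0 ((lam + 1 / 2) * b) ((lam + 1 / 2) * (2 * c)) (r / 2) 0
      h.c1 h.c1 h.c1 h.c2 := by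
  funext x
  simp [Ld, Fm, add_c1, sub_c1, smul_c1, mul_c1, dx_c0, dx_c1, eta1_c0, eta2_c0, eta1_c1,
    eta2_c1, mkE, sgn, deriv_q]
  ring
theorem LdE_c2 : (Ld lam false (mkE a b c r) h).c2 =
    Fm a b c 0 0 ((lam + 1 / 2) * b) ((lam + 1 / 2) * (2 * c)) (-r / 2) 0
      h.c2 h.c2 h.c2 h.c1 := by
  funext x
  simp [Ld, Fm, add_c2, sub_c2, smul_c2, mul_c2, dx_c0, dx_c2, eta1_c0, eta2_c0, eta1_c2,
    eta2_c2, mkE, sgn, deriv_q]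
  ring
theorem LdE_c12 : (Ld lam false (mkE a b c r) h).c12 =
    Fm a b c 0 0 ((lam + 1) * b) ((lam + 1) * (2 * c)) 0 0
      h.c12 h.c12 h.c12 h.c12 := by
  funext x
  simp [Ld, Fm, add_c12, sub_c12, smul_c12, mul_c12, dx_c0, dx_c1, dx_c2, dx_c12,
    eta1_c0, eta2_c0, eta1_c1, eta2_c1, eta1_c2, eta2_c2, eta1_c12, eta2_c12, mkE, sgn, deriv_q]
  ring
theorem LdO_c0 : (Ld lam true (mkO d p e q) h).c0 =
    Fm 0 0 0 0 0 (d / 2) (p / 2) (e / 2) (q / 2) h.c1 h.c1 h.c1 h.c2 := by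
  funext x
  simp [Ld, Fm, add_c0, sub_c0, smul_c0, mul_c0, dx_c0, eta1_c0, eta2_c0, mkO, sgn]
  ring
theorem LdO_c1 : (Ld lam true (mkO d p e q) h).c1 =
    Fm (d / 2) (p / 2) 0 0 0 (lam * p) 0 (-e / 2) (-q / 2) h.c0 h.c0 h.c0 h.c12 := by
  funext x
  simp [Ld, Fm, add_c1, sub_c1, smul_c1, mul_c1, dx_c0, dx_c1, eta1_c0, eta2_c0, eta1_c1,
    eta2_c1, mkO, sgn, deriv_l]
  ring
theorem LdO_c2 : (Ld lam true (mkO d p e q) h).c2 =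
    Fm (e / 2) (q / 2) 0 0 0 (lam * q) 0 (d / 2) (p / 2) h.c0 h.c0 h.c0 h.c12 := by
  funext x
  simp [Ld, Fm, add_c2, sub_c2, smul_c2, mul_c2, dx_c0, dx_c2, eta1_c0, eta2_c0, eta1_c2,
    eta2_c2, mkO, sgn, deriv_l]
  ring
theorem LdO_c12 : (Ld lam true (mkO d p e q) h).c12 =
    Fm (d / 2) (p / 2) 0 (-e / 2) (-q / 2) ((lam + 1 / 2) * p) 0 (-(lam + 1 / 2) * q) 0
      h.c2 h.c1 h.c2 h.c1 := by
  funext x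
  simp [Ld, Fm, add_c12, sub_c12, smul_c12, mul_c12, dx_c0, dx_c1, dx_c2, dx_c12,
    eta1_c0, eta2_c0, eta1_c1, eta2_c1, eta1_c2, eta2_c2, eta1_c12, eta2_c12, mkO, sgn, deriv_l]
  ring
end Ldcomps

theorem cbr_eq (p : Bool) (f g : SA) : cbr p f g = Ld (-1) p f g := by
  ext x <;> simp [cbr, Ld, add_c0, sub_c0, smul_c0, add_c1, sub_c1, smul_c1, add_c2, sub_c2,
    smul_c2, add_c12, sub_c12, smul_c12] <;> ring

theorem cbr_EE (a b c r A B C R : ℝ) : cbr false (mkE a b c r) (mkE A B C R)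
    = mkE (a * B - b * A) (2 * (a * C - c * A)) (b * C - c * B) 0 := by
  rw [cbr_eq]
  ext x
  · rw [LdE_c0]; simp [Fm, mkE, deriv_q]; ring
  · rw [LdE_c1]; simp [Fm, mkE]
  · rw [LdE_c2]; simp [Fm, mkE]
  · rw [LdE_c12]; simp [Fm, mkE]

theorem cbr_EO (a b c r D P E Q : ℝ) : cbr false (mkE a b c r) (mkO D P E Q)
    = mkO (a * P - b * D / 2 + r * E / 2) (b * P / 2 - c * D + r * Q / 2)
        (a * Q - b * E / 2 - r * D / 2) (b * Q / 2 - c * E - r * P / 2) := by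
  rw [cbr_eq]
  ext x
  · rw [LdE_c0]; simp [Fm, mkO]
  · rw [LdE_c1]; simp [Fm, mkO, deriv_l]; ring
  · rw [LdE_c2]; simp [Fm, mkO, deriv_l]; ring
  · rw [LdE_c12]; simp [Fm, mkO]

theorem cbr_OE (d p e q A B C R : ℝ) : cbr true (mkO d p e q) (mkE A B C R)
    = mkO (d * B / 2 - p * A - e * R / 2) (d * C - p * B / 2 - q * R / 2)
        (e * B / 2 - q * A + d * R / 2) (e * C - q * B / 2 + p * R / 2) := by
  rw [cbr_eq]
  ext x
  · rw [LdO_c0]; simp [Fm, mkE, mkO]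
  · rw [LdO_c1]; simp [Fm, mkE, mkO, deriv_q]; ring
  · rw [LdO_c2]; simp [Fm, mkE, mkO, deriv_q]; ring
  · rw [LdO_c12]; simp [Fm, mkE, mkO]

theorem cbr_OO (d p e q D P E Q : ℝ) : cbr true (mkO d p e q) (mkO D P E Q)
    = mkE ((d * D + e * E) / 2) ((d * P + p * D + e * Q + q * E) / 2) ((p * P + q * Q) / 2)
        ((d * Q - e * P - p * E + q * D) / 2) := by
  rw [cbr_eq]
  ext x
  · rw [LdO_c0]; simp [Fm, mkE, mkO]; ring
  · rw [LdO_c1]; simp [Fm, mkE, mkO]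
  · rw [LdO_c2]; simp [Fm, mkE, mkO]
  · rw [LdO_c12]; simp [Fm, mkE, mkO, deriv_l]; ring

theorem deriv_neg_const_mul (s : ℝ) (u : ℝ → ℝ) :
    deriv (fun x => s * u x) = fun x => s * deriv u x := by
  funext x; exact deriv_const_mul_field s

theorem ndx_iter (n : ℕ) (f : SA) :
    (ndx^[n] f).c0 = (fun x => (-1) ^ n * J f.c0 n x) ∧
    (ndx^[n] f).c1 = (fun x => (-1) ^ n * J f.c1 n x) ∧
    (ndx^[n] f).c2 = (fun x => (-1) ^ n * J f.c2 n x) ∧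
    (ndx^[n] f).c12 = (fun x => (-1) ^ n * J f.c12 n x) := by
  induction n with
  | zero => simp [J_zero]
  | succ n ih =>
    obtain ⟨i0, i1, i2, i3⟩ := ih
    rw [Function.iterate_succ_apply']
    refine ⟨?_, ?_, ?_, ?_⟩ <;> funext x
    · change -deriv (ndx^[n] f).c0 x = _
      rw [i0, deriv_neg_const_mul, J_succ]; ring
    · change -deriv (ndx^[n] f).c1 x = _
      rw [i1, deriv_neg_const_mul, J_succ]; ring
    · change -deriv (ndx^[n] f).c2 x = _
      rw [i2, deriv_neg_const_mul, J_succ]; ring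
    · change -deriv (ndx^[n] f).c12 x = _
      rw [i3, deriv_neg_const_mul, J_succ]; ring

theorem deriv_fun_neg2 (u : ℝ → ℝ) : deriv (fun x => -u x) = fun x => -deriv u x := by
  funext x; exact deriv.fun_neg

section Gcomps
variable (k : ℕ) (a b c r d p e q : ℝ) (h : SA)

theorem ndx_c0 (n : ℕ) (f : SA) : (ndx^[n] f).c0 = fun x => (-1) ^ n * J f.c0 n x :=
  (ndx_iter n f).1
theorem ndx_c1 (n : ℕ) (f : SA) : (ndx^[n] f).c1 = fun x => (-1) ^ n * J f.c1 n x :=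
  (ndx_iter n f).2.1
theorem ndx_c2 (n : ℕ) (f : SA) : (ndx^[n] f).c2 = fun x => (-1) ^ n * J f.c2 n x :=
  (ndx_iter n f).2.2.1
theorem ndx_c12 (n : ℕ) (f : SA) : (ndx^[n] f).c12 = fun x => (-1) ^ n * J f.c12 n x :=
  (ndx_iter n f).2.2.2

theorem mkE_c0 : (mkE a b c r).c0 = fun x => a + b * x + c * x ^ 2 := rfl
theorem mkE_c1 : (mkE a b c r).c1 = fun _ => 0 := rfl
theorem mkE_c2 : (mkE a b c r).c2 = fun _ => 0 := rfl
theorem mkE_c12 : (mkE a b c r).c12 = fun _ => r := rfl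
theorem mkO_c0 : (mkO d p e q).c0 = fun _ => 0 := rfl
theorem mkO_c1 : (mkO d p e q).c1 = fun x => d + p * x := rfl
theorem mkO_c2 : (mkO d p e q).c2 = fun x => e + q * x := rfl
theorem mkO_c12 : (mkO d p e q).c12 = fun _ => 0 := rfl

theorem GE_c0 : (GamB k false (mkE a b c r) h).c0 = fun x =>
    (-((k : ℝ) - 1) * (2 * c) * (-1) ^ (k - 2)) * J h.c12 (k - 2) x
      + 0 * J h.c12 (k - 2) x := by
  funext x
  simp [GamB, sgn, add_c0, smul_c0, sub_c0, mul_c0, dx_c0, dx_c1, dx_c2, dx_c12, mkE_c0, mkE_c1,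
    mkE_c2, mkE_c12, mkO_c0, mkO_c1, mkO_c2, mkO_c12, deriv_l, deriv_q, eta1_c0, eta2_c0, eta2_c1,
    eta1_c1, eta2_c2, eta1_c2, eta1_c12, eta2_c12, ndx_c12, ndx_c2, ndx_c1, ndx_c0, J_neg, J_deriv,
    J_succ, deriv_neg_const_mul, deriv_fun_neg2]
  try ring
theorem GE_c1 : (GamB k false (mkE a b c r) h).c1 = fun x =>
    (-((k : ℝ) - 1) * (2 * c) * (-1) ^ (k - 2)) * J h.c2 (k - 2 + 1) x
      + (2 * c * (-1) ^ (k - 1)) * J h.c2 (k - 1) x := by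
  funext x
  simp [GamB, sgn, add_c1, smul_c1, sub_c1, mul_c1, dx_c0, dx_c1, dx_c2, dx_c12, mkE_c0, mkE_c1,
    mkE_c2, mkE_c12, mkO_c0, mkO_c1, mkO_c2, mkO_c12, deriv_l, deriv_q, eta1_c0, eta2_c0, eta2_c1,
    eta1_c1, eta2_c2, eta1_c2, eta1_c12, eta2_c12, ndx_c12, ndx_c2, ndx_c1, ndx_c0, J_neg, J_deriv,
    J_succ, deriv_neg_const_mul, deriv_fun_neg2]
  try ring
theorem GE_c2 : (GamB k false (mkE a b c r) h).c2 = fun x =>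
    (((k : ℝ) - 1) * (2 * c) * (-1) ^ (k - 2)) * J h.c1 (k - 2 + 1) x
      + (-(2 * c) * (-1) ^ (k - 1)) * J h.c1 (k - 1) x := by
  funext x
  simp [GamB, sgn, add_c2, smul_c2, sub_c2, mul_c2, dx_c0, dx_c1, dx_c2, dx_c12, mkE_c0, mkE_c1,
    mkE_c2, mkE_c12, mkO_c0, mkO_c1, mkO_c2, mkO_c12, deriv_l, deriv_q, eta1_c0, eta2_c0, eta2_c1,
    eta1_c1, eta2_c2, eta1_c2, eta1_c12, eta2_c12, ndx_c12, ndx_c2, ndx_c1, ndx_c0, J_neg, J_deriv,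
    J_succ, deriv_neg_const_mul, deriv_fun_neg2]
  try ring
theorem GE_c12 : (GamB k false (mkE a b c r) h).c12 = fun x =>
    (((k : ℝ) - 1) * (2 * c) * (-1) ^ (k - 2)) * J h.c0 (k - 2 + 2) x
      + (-(4 * c) * (-1) ^ (k - 1)) * J h.c0 (k - 1 + 1) x := by
  funext x
  simp [GamB, sgn, add_c12, smul_c12, sub_c12, mul_c12, dx_c0, dx_c1, dx_c2, dx_c12, mkE_c0, mkE_c1,
    mkE_c2, mkE_c12, mkO_c0, mkO_c1, mkO_c2, mkO_c12, deriv_l, deriv_q, eta1_c0, eta2_c0, eta2_c1,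
    eta1_c1, eta2_c2, eta1_c2, eta1_c12, eta2_c12, ndx_c12, ndx_c2, ndx_c1, ndx_c0, J_neg, J_deriv,
    J_succ, deriv_neg_const_mul, deriv_fun_neg2]
  try ring
theorem GO_c0 : (GamB k true (mkO d p e q) h).c0 = fun x =>
    (-q * (-1) ^ (k - 1)) * J h.c1 (k - 1) x + (p * (-1) ^ (k - 1)) * J h.c2 (k - 1) x := by
  funext x
  simp [GamB, sgn, add_c0, smul_c0, sub_c0, mul_c0, dx_c0, dx_c1, dx_c2, dx_c12, mkE_c0, mkE_c1,
    mkE_c2, mkE_c12, mkO_c0, mkO_c1, mkO_c2, mkO_c12, deriv_l, deriv_q, eta1_c0, eta2_c0, eta2_c1,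
    eta1_c1, eta2_c2, eta1_c2, eta1_c12, eta2_c12, ndx_c12, ndx_c2, ndx_c1, ndx_c0, J_neg, J_deriv,
    J_succ, deriv_neg_const_mul, deriv_fun_neg2]
  try ring
theorem GO_c1 : (GamB k true (mkO d p e q) h).c1 = fun x =>
    (q * (-1) ^ (k - 1)) * J h.c0 (k - 1 + 1) x + (-p * (-1) ^ (k - 1)) * J h.c12 (k - 1) x := by
  funext x
  simp [GamB, sgn, add_c1, smul_c1, sub_c1, mul_c1, dx_c0, dx_c1, dx_c2, dx_c12, mkE_c0, mkE_c1,
    mkE_c2, mkE_c12, mkO_c0, mkO_c1, mkO_c2, mkO_c12, deriv_l, deriv_q, eta1_c0, eta2_c0, eta2_c1,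
    eta1_c1, eta2_c2, eta1_c2, eta1_c12, eta2_c12, ndx_c12, ndx_c2, ndx_c1, ndx_c0, J_neg, J_deriv,
    J_succ, deriv_neg_const_mul, deriv_fun_neg2]
  try ring
theorem GO_c2 : (GamB k true (mkO d p e q) h).c2 = fun x =>
    (-q * (-1) ^ (k - 1)) * J h.c12 (k - 1) x
      + (-p * (-1) ^ (k - 1)) * J h.c0 (k - 1 + 1) x := by
  funext x
  simp [GamB, sgn, add_c2, smul_c2, sub_c2, mul_c2, dx_c0, dx_c1, dx_c2, dx_c12, mkE_c0, mkE_c1,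
    mkE_c2, mkE_c12, mkO_c0, mkO_c1, mkO_c2, mkO_c12, deriv_l, deriv_q, eta1_c0, eta2_c0, eta2_c1,
    eta1_c1, eta2_c2, eta1_c2, eta1_c12, eta2_c12, ndx_c12, ndx_c2, ndx_c1, ndx_c0, J_neg, J_deriv,
    J_succ, deriv_neg_const_mul, deriv_fun_neg2]
  try ring
theorem GO_c12 : (GamB k true (mkO d p e q) h).c12 = fun x =>
    (q * (-1) ^ (k - 1)) * J h.c2 (k - 1 + 1) x
      + (p * (-1) ^ (k - 1)) * J h.c1 (k - 1 + 1) x := by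
  funext x
  simp [GamB, sgn, add_c12, smul_c12, sub_c12, mul_c12, dx_c0, dx_c1, dx_c2, dx_c12, mkE_c0, mkE_c1,
    mkE_c2, mkE_c12, mkO_c0, mkO_c1, mkO_c2, mkO_c12, deriv_l, deriv_q, eta1_c0, eta2_c0, eta2_c1,
    eta1_c1, eta2_c2, eta1_c2, eta1_c12, eta2_c12, ndx_c12, ndx_c2, ndx_c1, ndx_c0, J_neg, J_deriv,
    J_succ, deriv_neg_const_mul, deriv_fun_neg2]
  try ring
end Gcomps

/-- for every `k ≥ 1`,
`Γ̄_k(f) = (k-1) m_{f''}∘η̄₁∘η̄₂^{2k-3} + (-1)^{|f|}(m_{η̄₂(f')}∘η̄₁^{2k-1} - m_{η̄₁(f')}∘η̄₂^{2k-1})`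
(first term absent for `k = 1`) is a 1-cocycle of `𝔬𝔰𝔭(2|2)` with values in `𝔇_{-k/2,k/2}`. -/
theorem GamB_is_cocycle :
    ∀ (k : ℕ), 1 ≤ k →
      ∀ (p q : Bool) (f g : SA),
        Homog p f → Homog q g → memOsp f → memOsp g →
        ∀ h : SA,
          act (-(k : ℝ) / 2) ((k : ℝ) / 2) p q f (GamB k q g) h
              - sgn (p && q) • act (-(k : ℝ) / 2) ((k : ℝ) / 2) q p g (GamB k p f) h
            = GamB k (p ^^ q) (cbr p f g) h := by
  intro k hk p q f g hf hg mf mg h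
  have s0 := h.h0
  have s1 := h.h1
  have s2 := h.h2
  have s3 := h.h12
  obtain rfl | rfl | ⟨m, rfl⟩ : k = 1 ∨ k = 2 ∨ ∃ m, k = m + 3 := by
    rcases k with _ | _ | _ | m
    · omega
    · simp
    · simp
    · exact Or.inr (Or.inr ⟨m, rfl⟩)
  all_goals
    cases p <;> cases q
    · obtain ⟨a, b, c, r, rfl⟩ := exists_mkE mf hf
      obtain ⟨A, B, C, R, rfl⟩ := exists_mkE mg hg
      simp only [act, Bool.xor_false, Bool.xor_true, Bool.not_true, Bool.not_false, cbr_EE]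
      ext x
      all_goals
        simp only [sub_c0, sub_c1, sub_c2, sub_c12, smul_c0, smul_c1, smul_c2, smul_c12,
          LdE_c0, LdE_c1, LdE_c2, LdE_c12, LdO_c0, LdO_c1, LdO_c2, LdO_c12,
          GE_c0, GE_c1, GE_c2, GE_c12, GO_c0, GO_c1, GO_c2, GO_c12,
          J_Fm _ _ _ _ _ _ _ _ _ s0 s0 s0 s0, J_Fm _ _ _ _ _ _ _ _ _ s1 s1 s1 s2,
          J_Fm _ _ _ _ _ _ _ _ _ s2 s2 s2 s1, J_Fm _ _ _ _ _ _ _ _ _ s3 s3 s3 s3,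
          J_Fm _ _ _ _ _ _ _ _ _ s0 s0 s0 s3, J_Fm _ _ _ _ _ _ _ _ _ s2 s1 s2 s1]
        simp only [Fm, deriv_J2 _ _ s0 s0, deriv_J2 _ _ s1 s1, deriv_J2 _ _ s2 s2,
          deriv_J2 _ _ s3 s3, deriv_J2 _ _ s1 s2, deriv_J2 _ _ s2 s1, deriv_J2 _ _ s0 s3,
          deriv_J2 _ _ s3 s0]
        simp only [sgn, Bool.and_true, Bool.and_false, if_true, if_false, Bool.false_eq_true,
          Nat.reduceAdd, Nat.reduceSub, Nat.reduceSubDiff, Nat.add_sub_cancel, add_assoc,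
          add_tsub_cancel_right]
        push_cast
        ring
    · obtain ⟨a, b, c, r, rfl⟩ := exists_mkE mf hf
      obtain ⟨A, B, C, R, rfl⟩ := exists_mkO mg hg
      simp only [act, Bool.xor_false, Bool.xor_true, Bool.not_true, Bool.not_false, cbr_EO]
      ext x
      all_goals
        simp only [sub_c0, sub_c1, sub_c2, sub_c12, smul_c0, smul_c1, smul_c2, smul_c12,
          LdE_c0, LdE_c1, LdE_c2, LdE_c12, LdO_c0, LdO_c1, LdO_c2, LdO_c12,
          GE_c0, GE_c1, GE_c2, GE_c12, GO_c0, GO_c1, GO_c2, GO_c12,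
          J_Fm _ _ _ _ _ _ _ _ _ s0 s0 s0 s0, J_Fm _ _ _ _ _ _ _ _ _ s1 s1 s1 s2,
          J_Fm _ _ _ _ _ _ _ _ _ s2 s2 s2 s1, J_Fm _ _ _ _ _ _ _ _ _ s3 s3 s3 s3,
          J_Fm _ _ _ _ _ _ _ _ _ s0 s0 s0 s3, J_Fm _ _ _ _ _ _ _ _ _ s2 s1 s2 s1]
        simp only [Fm, deriv_J2 _ _ s0 s0, deriv_J2 _ _ s1 s1, deriv_J2 _ _ s2 s2,
          deriv_J2 _ _ s3 s3, deriv_J2 _ _ s1 s2, deriv_J2 _ _ s2 s1, deriv_J2 _ _ s0 s3,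
          deriv_J2 _ _ s3 s0]
        simp only [sgn, Bool.and_true, Bool.and_false, if_true, if_false, Bool.false_eq_true,
          Nat.reduceAdd, Nat.reduceSub, Nat.reduceSubDiff, Nat.add_sub_cancel, add_assoc,
          add_tsub_cancel_right]
        push_cast
        ring
    · obtain ⟨a, b, c, r, rfl⟩ := exists_mkO mf hf
      obtain ⟨A, B, C, R, rfl⟩ := exists_mkE mg hg
      simp only [act, Bool.xor_false, Bool.xor_true, Bool.not_true, Bool.not_false, cbr_OE]
      ext x
      all_goals
        simp only [sub_c0, sub_c1, sub_c2, sub_c12, smul_c0, smul_c1, smul_c2, smul_c12,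
          LdE_c0, LdE_c1, LdE_c2, LdE_c12, LdO_c0, LdO_c1, LdO_c2, LdO_c12,
          GE_c0, GE_c1, GE_c2, GE_c12, GO_c0, GO_c1, GO_c2, GO_c12,
          J_Fm _ _ _ _ _ _ _ _ _ s0 s0 s0 s0, J_Fm _ _ _ _ _ _ _ _ _ s1 s1 s1 s2,
          J_Fm _ _ _ _ _ _ _ _ _ s2 s2 s2 s1, J_Fm _ _ _ _ _ _ _ _ _ s3 s3 s3 s3,
          J_Fm _ _ _ _ _ _ _ _ _ s0 s0 s0 s3, J_Fm _ _ _ _ _ _ _ _ _ s2 s1 s2 s1]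
        simp only [Fm, deriv_J2 _ _ s0 s0, deriv_J2 _ _ s1 s1, deriv_J2 _ _ s2 s2,
          deriv_J2 _ _ s3 s3, deriv_J2 _ _ s1 s2, deriv_J2 _ _ s2 s1, deriv_J2 _ _ s0 s3,
          deriv_J2 _ _ s3 s0]
        simp only [sgn, Bool.and_true, Bool.and_false, if_true, if_false, Bool.false_eq_true,
          Nat.reduceAdd, Nat.reduceSub, Nat.reduceSubDiff, Nat.add_sub_cancel, add_assoc,
          add_tsub_cancel_right]
        push_cast
        ring
    · obtain ⟨a, b, c, r, rfl⟩ := exists_mkO mf hf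
      obtain ⟨A, B, C, R, rfl⟩ := exists_mkO mg hg
      simp only [act, Bool.xor_false, Bool.xor_true, Bool.not_true, Bool.not_false, cbr_OO]
      ext x
      all_goals
        simp only [sub_c0, sub_c1, sub_c2, sub_c12, smul_c0, smul_c1, smul_c2, smul_c12,
          LdE_c0, LdE_c1, LdE_c2, LdE_c12, LdO_c0, LdO_c1, LdO_c2, LdO_c12,
          GE_c0, GE_c1, GE_c2, GE_c12, GO_c0, GO_c1, GO_c2, GO_c12,
          J_Fm _ _ _ _ _ _ _ _ _ s0 s0 s0 s0, J_Fm _ _ _ _ _ _ _ _ _ s1 s1 s1 s2,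
          J_Fm _ _ _ _ _ _ _ _ _ s2 s2 s2 s1, J_Fm _ _ _ _ _ _ _ _ _ s3 s3 s3 s3,
          J_Fm _ _ _ _ _ _ _ _ _ s0 s0 s0 s3, J_Fm _ _ _ _ _ _ _ _ _ s2 s1 s2 s1]
        simp only [Fm, deriv_J2 _ _ s0 s0, deriv_J2 _ _ s1 s1, deriv_J2 _ _ s2 s2,
          deriv_J2 _ _ s3 s3, deriv_J2 _ _ s1 s2, deriv_J2 _ _ s2 s1, deriv_J2 _ _ s0 s3,
          deriv_J2 _ _ s3 s0]
        simp only [sgn, Bool.and_true, Bool.and_false, if_true, if_false, Bool.false_eq_true,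
          Nat.reduceAdd, Nat.reduceSub, Nat.reduceSubDiff, Nat.add_sub_cancel, add_assoc,
          add_tsub_cancel_right]
        push_cast
        ring

end SA
end OSP
end
end
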